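/- (Lemma: the randomized shifted algorithm is (2 − 1/d²)-competitive on paths.) Let d ≥ 2 and let 𝒫 be a finite set of interval paths each of length at least d + 1. For each i with 0 ≤ i ≤ d − 1 define R_i := { x ∈ ℤ : x ≡ i (mod d) and x is an internal node of some path of 𝒫 }. Then each R_i d-satisfies every path of 𝒫, and for every finite set R* ⊆ ℤ that d-satisfies every path of 𝒫, d · Σ_{i=0}^{d−1} |R_i| ≤ (2d² − 1) · |R*|; equivalently, the average of |R_i| over a uniformly random shift i is at most (2 − 1/d²) · |R*|. -/

import Mathlib

/-- `v` is an internal node of the interval path `P(s,t)`. -/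
def IsInternal (s t v : ℤ) : Prop := s < v ∧ v < t

/-- The interval path `P(s,t)` is `d`-satisfied by the set `R` of regenerator
locations: among every `d` consecutive internal nodes of `P(s,t)` there is an
element of `R`. -/
def DSat (d s t : ℤ) (R : Set ℤ) : Prop :=
  ∀ x : ℤ, s + 1 ≤ x → x + d - 1 ≤ t - 1 → ∃ r ∈ R, x ≤ r ∧ r ≤ x + d - 1

/-- A node that is internal to a path of length at least `d + 1` is at distance less than `d`
from every feasible set of regenerators. -/
theorem DSat.exists_near {d s t u : ℤ} {R : Set ℤ} (h : DSat d s t R) (hd : 1 ≤ d)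
    (hlen : d + 1 ≤ t - s) (hu : IsInternal s t u) :
    ∃ r ∈ R, r - (d - 1) ≤ u ∧ u ≤ r + (d - 1) := by
  obtain ⟨hsu, hut⟩ := hu
  rcases le_total u (t - d) with hle | hle
  · obtain ⟨r, hr, h₁, h₂⟩ := h u (by omega) (by omega)
    exact ⟨r, hr, by omega, by omega⟩
  · obtain ⟨r, hr, h₁, h₂⟩ := h (t - d) (by omega) (by omega)
    exact ⟨r, hr, by omega, by omega⟩

/-- The internal nodes of a path lying in a fixed residue class modulo `d` satisfy the path. -/
theorem DSat.of_residue_class {d s t i : ℤ} {R : Set ℤ} (hd : 0 < d)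
    (hR : ∀ x, x % d = i % d → IsInternal s t x → x ∈ R) : DSat d s t R := by
  intro x hx₁ hx₂
  have h₀ := Int.emod_nonneg (i - x) hd.ne'
  have h₁ := Int.emod_lt_of_pos (i - x) hd
  refine ⟨x + (i - x) % d, hR _ ?_ ⟨by omega, by omega⟩, by omega, by omega⟩
  rw [Int.add_emod_emod, add_sub_cancel]

/-- Splitting a finset of integers into residue classes modulo `d` preserves its cardinality. -/
theorem sum_card_filter_emod {d : ℤ} (hd : 0 < d) (B : Finset ℤ) :
    ∑ i ∈ Finset.Ico (0 : ℤ) d, (B.filter (fun x => x % d = i)).card = B.card :=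
  (Finset.card_eq_sum_card_fiberwise fun x _ => by
    simpa using ⟨Int.emod_nonneg x hd.ne', Int.emod_lt_of_pos x hd⟩).symm

/-- The randomized shifted algorithm is `(2 - 1/d²)`-competitive: each shifted
set `R_i` is feasible, and the sum over the `d` shifts of `|R_i|` is at most
`(2d² - 1)/d` times the optimum cost. -/
theorem stmt4 (d : ℤ) (hd : 2 ≤ d) (Ps : Finset (ℤ × ℤ))
    (hlen : ∀ P ∈ Ps, d + 1 ≤ P.2 - P.1) :
    (∀ i ∈ Finset.Ico (0 : ℤ) d, ∀ P ∈ Ps,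
      DSat d P.1 P.2 {x : ℤ | x % d = i % d ∧ ∃ Q ∈ Ps, IsInternal Q.1 Q.2 x}) ∧
    (∀ R : Finset ℤ, (∀ P ∈ Ps, DSat d P.1 P.2 (R : Set ℤ)) →
      d * (∑ i ∈ Finset.Ico (0 : ℤ) d,
          ({x : ℤ | x % d = i % d ∧ ∃ Q ∈ Ps, IsInternal Q.1 Q.2 x}.ncard : ℤ))
        ≤ (2 * d ^ 2 - 1) * (R.card : ℤ)) := by
  refine ⟨fun i _ P hP => DSat.of_residue_class (by omega) fun x hx hxP => ⟨hx, P, hP, hxP⟩, ?_⟩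
  intro R hR
  let B : Finset ℤ := R.biUnion fun r => Finset.Icc (r - (d - 1)) (r + (d - 1))
  have hB : (B.card : ℤ) ≤ R.card * (2 * d - 1) := by
    have h := Finset.card_biUnion_le_card_mul R
      (fun r => Finset.Icc (r - (d - 1)) (r + (d - 1))) (2 * d - 1).toNat
      fun r _ => by rw [Int.card_Icc]; omega
    calc (B.card : ℤ) ≤ ((R.card * (2 * d - 1).toNat : ℕ) : ℤ) := by exact_mod_cast h
      _ = R.card * (2 * d - 1) := by rw [Nat.cast_mul, Int.toNat_of_nonneg (by omega)]
  have hsum : ∑ i ∈ Finset.Ico (0 : ℤ) d,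
      ({x : ℤ | x % d = i % d ∧ ∃ Q ∈ Ps, IsInternal Q.1 Q.2 x}.ncard : ℤ) ≤ B.card := by
    rw [← sum_card_filter_emod (by omega : 0 < d) B, Nat.cast_sum]
    refine Finset.sum_le_sum fun i hi => ?_
    rw [Finset.mem_Ico] at hi
    rw [← Set.ncard_coe_finset, Nat.cast_le]
    refine Set.ncard_le_ncard ?_ (Finset.finite_toSet _)
    rintro x ⟨hx, Q, hQ, hxQ⟩
    obtain ⟨r, hr, h₁, h₂⟩ := (hR Q hQ).exists_near (by omega) (hlen Q hQ) hxQ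
    rw [Int.emod_eq_of_lt hi.1 hi.2] at hx
    exact Finset.mem_coe.2 (Finset.mem_filter.2
      ⟨Finset.mem_biUnion.2 ⟨r, hr, Finset.mem_Icc.2 ⟨h₁, h₂⟩⟩, hx⟩)
  have hcard : (0 : ℤ) ≤ R.card := Nat.cast_nonneg _
  calc _ ≤ d * (R.card * (2 * d - 1)) :=
        mul_le_mul_of_nonneg_left (hsum.trans hB) (by omega)
    _ ≤ (2 * d ^ 2 - 1) * R.card := by nlinarith
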